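/- arXiv:1706.07417 — 2 statements merged into one kernel-verified Lean document; each statement's English description precedes it below -/
import Mathlib

section
/- Let h > 0, θ ∈ (−3/8, 3/8), and let n ≥ 1 be an integer. Then there exists α > 0 such that for every l ∈ ℤ with l ∉ {n, −n}, both |g_θ(n) − g_θ(l)| ≥ α·⟨l − n⟩ and |g_θ(−n) − g_θ(l)| ≥ α·⟨l + n⟩. -/
/-- The Japanese bracket `⟨m⟩ = √(2(m² + 1))` of an integer `m`. -/
noncomputable def bracket (m : ℤ) : ℝ := Real.sqrt (2 * ((m : ℝ) ^ 2 + 1))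

/-- The flat-bottom dispersion function `g_θ(k) = (k + θ)·tanh(h·(k + θ))`. -/
noncomputable def dispersion (h θ : ℝ) (k : ℤ) : ℝ :=
  ((k : ℝ) + θ) * Real.tanh (h * ((k : ℝ) + θ))

theorem tanh_monotone_real : Monotone Real.tanh := by
  intro a b hab
  rw [Real.tanh_eq_sinh_div_cosh, Real.tanh_eq_sinh_div_cosh,
    div_le_div_iff₀ (Real.cosh_pos a) (Real.cosh_pos b)]
  have h₁ : 0 ≤ Real.sinh (b - a) := Real.sinh_nonneg_iff.2 (sub_nonneg.2 hab)
  rw [Real.sinh_sub] at h₁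
  linarith

theorem bracket_le_two_mul_abs {m : ℤ} (hm : m ≠ 0) : bracket m ≤ 2 * |(m : ℝ)| := by
  have h₁ : (1 : ℝ) ≤ |(m : ℝ)| := by exact_mod_cast Int.one_le_abs hm
  refine Real.sqrt_le_iff.2 ⟨by positivity, ?_⟩
  nlinarith [sq_abs (m : ℝ)]

theorem mul_tanh_eq_abs_mul_tanh_abs (h x : ℝ) :
    x * Real.tanh (h * x) = |x| * Real.tanh (h * |x|) := by
  rcases abs_cases x with ⟨hx, -⟩ | ⟨hx, -⟩ <;> simp [hx]

theorem sub_mul_tanh_le {h a b : ℝ} (hh : 0 ≤ h) (hb : 0 ≤ b) (hab : b ≤ a) :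
    (a - b) * Real.tanh (h * a) ≤ a * Real.tanh (h * a) - b * Real.tanh (h * b) := by
  have h₁ := mul_le_mul_of_nonneg_left
    (tanh_monotone_real (mul_le_mul_of_nonneg_left hab hh)) hb
  linarith

theorem abs_sub_mul_tanh_le {h c x y : ℝ} (hh : 0 ≤ h) (hc : c ≤ |x|) :
    |(|x| - |y|)| * Real.tanh (h * c) ≤
      |x * Real.tanh (h * x) - y * Real.tanh (h * y)| := by
  rw [mul_tanh_eq_abs_mul_tanh_abs h x, mul_tanh_eq_abs_mul_tanh_abs h y]
  rcases le_total |y| |x| with hxy | hxy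
  · rw [abs_of_nonneg (sub_nonneg.2 hxy)]
    refine le_trans ?_ ((sub_mul_tanh_le hh (abs_nonneg y) hxy).trans (le_abs_self _))
    exact mul_le_mul_of_nonneg_left (tanh_monotone_real (mul_le_mul_of_nonneg_left hc hh))
      (sub_nonneg.2 hxy)
  · rw [abs_sub_comm |x|, abs_sub_comm (|x| * _), abs_of_nonneg (sub_nonneg.2 hxy)]
    refine le_trans ?_ ((sub_mul_tanh_le hh (abs_nonneg x) hxy).trans (le_abs_self _))
    exact mul_le_mul_of_nonneg_left
      (tanh_monotone_real (mul_le_mul_of_nonneg_left (hc.trans hxy) hh)) (sub_nonneg.2 hxy)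

theorem abs_sub_le_mul_abs_abs_sub_abs {θ : ℝ} (hθ : |θ| < 3 / 8) {p l : ℤ} (hl : l ≠ -p) :
    |((l - p : ℤ) : ℝ)| ≤ 4 * (1 + 2 * |(p : ℝ)|) * |(|(p : ℝ) + θ| - |(l : ℝ) + θ|)| := by
  have h_sum : (1 : ℝ) ≤ |(l : ℝ) + p| := by
    exact_mod_cast Int.one_le_abs (z := l + p) (by omega)
  have hp := abs_nonneg (p : ℝ)
  push_cast
  have h_same : |(l : ℝ) - p| ≤ 4 * (1 + 2 * |(p : ℝ)|) * |(l : ℝ) - p| := by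
    nlinarith [abs_nonneg ((l : ℝ) - p)]
  have h_opp : |(l : ℝ) - p| ≤ 4 * (1 + 2 * |(p : ℝ)|) * |(l : ℝ) + p + 2 * θ| := by
    have h₁ : |(l : ℝ) + p| ≤ |(l : ℝ) + p + 2 * θ| + 2 * |θ| := by
      have := abs_sub ((l : ℝ) + p + 2 * θ) (2 * θ)
      rwa [add_sub_cancel_right, abs_mul, abs_two] at this
    have h₂ : |(l : ℝ) - p| ≤ |(l : ℝ) + p| + 2 * |(p : ℝ)| := by
      have := abs_sub ((l : ℝ) + p) (2 * p)
      rwa [abs_mul, abs_two, show (l : ℝ) + p - 2 * p = l - p by ring] at this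
    have h₃ : |(l : ℝ) + p| ≤ 4 * |(l : ℝ) + p + 2 * θ| := by linarith
    nlinarith
  rcases abs_cases ((p : ℝ) + θ) with ⟨h₁, -⟩ | ⟨h₁, -⟩ <;>
    rcases abs_cases ((l : ℝ) + θ) with ⟨h₂, -⟩ | ⟨h₂, -⟩ <;> rw [h₁, h₂]
  · rwa [add_sub_add_right_eq_sub, abs_sub_comm (p : ℝ)]
  · rwa [show (p : ℝ) + θ - -(l + θ) = l + p + 2 * θ by ring]
  · rwa [show -((p : ℝ) + θ) - (l + θ) = -(l + p + 2 * θ) by ring, abs_neg]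
  · rwa [show -((p : ℝ) + θ) - -(l + θ) = l - p by ring]

theorem dispersion_separation {h θ : ℝ} (hh : 0 < h) (hθ : |θ| < 3 / 8) {p l : ℤ}
    (hp : p ≠ 0) (hl₁ : l ≠ p) (hl₂ : l ≠ -p) :
    Real.tanh (h * (5 / 8)) / (8 * (1 + 2 * |(p : ℝ)|)) * bracket (l - p) ≤
      |dispersion h θ p - dispersion h θ l| := by
  have h_one : (1 : ℝ) ≤ |(p : ℝ)| := by exact_mod_cast Int.one_le_abs hp
  have h_low : (5 / 8 : ℝ) ≤ |(p : ℝ) + θ| := by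
    have := abs_sub ((p : ℝ) + θ) θ
    rw [add_sub_cancel_right] at this
    linarith
  have h_tanh : 0 ≤ Real.tanh (h * (5 / 8)) := by
    simpa using tanh_monotone_real (show 0 ≤ h * (5 / 8) by positivity)
  refine le_trans ?_ (abs_sub_mul_tanh_le hh.le h_low)
  rw [div_mul_eq_mul_div, div_le_iff₀ (by positivity)]
  have h₁ := (bracket_le_two_mul_abs (sub_ne_zero.2 hl₁)).trans
    (mul_le_mul_of_nonneg_left (abs_sub_le_mul_abs_abs_sub_abs hθ hl₂) zero_le_two)
  have h₂ := mul_le_mul_of_nonneg_left h₁ h_tanh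
  linarith

/-- For `h > 0`, `θ ∈ (−3/8, 3/8)` and an integer `n ≥ 1`, there is `α > 0` such that for
every `l ∉ {n, −n}`, `|g_θ(n) − g_θ(l)| ≥ α·⟨l − n⟩` and `|g_θ(−n) − g_θ(l)| ≥ α·⟨l + n⟩`. -/
theorem dispersion_eigenvalue_separation_double
    (h θ : ℝ) (hh : 0 < h) (hθ₁ : -(3 / 8) < θ) (hθ₂ : θ < 3 / 8) (n : ℤ) (hn : 1 ≤ n) :
    ∃ α : ℝ, 0 < α ∧ ∀ l : ℤ, l ≠ n → l ≠ -n →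
      α * bracket (l - n) ≤ |dispersion h θ n - dispersion h θ l| ∧
      α * bracket (l + n) ≤ |dispersion h θ (-n) - dispersion h θ l| := by
  have hθ : |θ| < 3 / 8 := abs_lt.2 ⟨hθ₁, hθ₂⟩
  have h_tanh : 0 < Real.tanh (h * (5 / 8)) := by
    rw [Real.tanh_eq_sinh_div_cosh]
    exact div_pos (Real.sinh_pos_iff.2 (by positivity)) (Real.cosh_pos _)
  refine ⟨Real.tanh (h * (5 / 8)) / (8 * (1 + 2 * |(n : ℝ)|)), by positivity,
    fun l hl₁ hl₂ => ⟨dispersion_separation hh hθ (by omega) hl₁ hl₂, ?_⟩⟩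
  simpa using dispersion_separation hh hθ (p := -n) (by omega) hl₂ (by simpa using hl₁)
end

section
/- For every h > 0, the real number −( (½·sech(h/2))² · ( (½·tanh(h/2))² − 9/4 ) ) / ( 4·( ½·tanh(h/2) − (3/2)·tanh(3h/2) ) ) is strictly negative. -/
theorem Real.tanh_strictMono : StrictMono Real.tanh := fun x y hxy => by
  rw [Real.tanh_eq_sinh_div_cosh, Real.tanh_eq_sinh_div_cosh,
    div_lt_div_iff₀ (Real.cosh_pos _) (Real.cosh_pos _)]
  have sinh_sub_pos : 0 < Real.sinh (y - x) := Real.sinh_pos_iff.2 (sub_pos.2 hxy)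
  rw [Real.sinh_sub] at sinh_sub_pos
  linarith

/-- For every depth `h > 0`, the order-`ε²` coefficient of the centre of the first
spectral gap for the bathymetry `b(x) = ε·cos x`, namely
`−( s₀²(1/2)·(g₀²(1/2) − 9/4) ) / ( 4·(g₀(1/2) − g₁(1/2)) )` with
`g₀(1/2) = ½·tanh(h/2)`, `g₁(1/2) = (3/2)·tanh(3h/2)`, `s₀(1/2) = ½·sech(h/2)`,
is strictly negative. -/
theorem first_gap_centre_downshift (h : ℝ) (hh : 0 < h) :
    -((1 / 2 * (Real.cosh (h / 2))⁻¹) ^ 2 * ((1 / 2 * Real.tanh (h / 2)) ^ 2 - 9 / 4) /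
        (4 * (1 / 2 * Real.tanh (h / 2) - 3 / 2 * Real.tanh (3 * h / 2)))) < 0 := by
  have tanh_pos : 0 < Real.tanh (h / 2) := by
    simpa using Real.tanh_strictMono (half_pos hh)
  have tanh_lt : Real.tanh (h / 2) < Real.tanh (3 * h / 2) :=
    Real.tanh_strictMono (by linarith)
  have tanh_lt_one := Real.tanh_lt_one (h / 2)
  have sech_pos : 0 < (Real.cosh (h / 2))⁻¹ := inv_pos.2 (Real.cosh_pos _)
  refine neg_neg_of_pos (div_pos_of_neg_of_neg ?_ (by linarith))
  exact mul_neg_of_pos_of_neg (by positivity) (by nlinarith)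
end
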